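/- arXiv:2402.16623 — 3 statements merged into one kernel-verified Lean document; each statement's English description precedes it below -/
import Mathlib

section
/- Assume: (a) either (0 < r < 1 and η > 0) or (r < 0); and (b) either (0 < r̃ < 1 and η̃ > 0) or (r̃ < 0), where η = rβ − 3/2 and η̃ = r̃β̃ − (M+2)/2. Then the generalized Gibbs energy functional G(x, θ, ν) is convex on the open convex region of all (x, θ, ν) ∈ ℝ^N × ℝ_{++}^K × ℝ_{++} with θ_i < ϑ_i (η/(r·|r − 1|))^{1/r} for every i = 1, …, K and ν < ϑ̃ (η̃/(r̃·|r̃ − 1|))^{1/r̃}. -/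
open Real Filter

/-- The generalized Gibbs energy functional
`G(x, θ, ν) = (1/(2ν))‖Fx − y‖₂² + (1/2)∑ᵢ ([Rx]ᵢ)²/θᵢ + (ν/ϑ̃)^r̃ + ∑ᵢ (θᵢ/ϑᵢ)^r
  − η̃ log ν − η ∑ᵢ log θᵢ`. -/
noncomputable def ggibbs (N M K : ℕ) (F : Matrix (Fin M) (Fin N) ℝ)
    (R : Matrix (Fin K) (Fin N) ℝ) (y : Fin M → ℝ)
    (r η rt ηt vtht : ℝ) (vth : Fin K → ℝ) :
    (Fin N → ℝ) × (Fin K → ℝ) × ℝ → ℝ :=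
  fun p =>
    (1 / (2 * p.2.2)) * ∑ j, (F.mulVec p.1 j - y j) ^ 2
      + (1 / 2) * ∑ i, (R.mulVec p.1 i) ^ 2 / p.2.1 i
      + (p.2.2 / vtht) ^ rt
      + ∑ i, (p.2.1 i / vth i) ^ r
      - ηt * Real.log p.2.2
      - η * ∑ i, Real.log (p.2.1 i)

/-- The quadratic-over-linear function `(u, t) ↦ u² / t` is convex for `t > 0`. -/
theorem sq_div_convexCombination_le {a b s t : ℝ} (u v : ℝ) (ha : 0 ≤ a) (hb : 0 ≤ b)
    (hs : 0 < s) (ht : 0 < t) (hst : 0 < a * s + b * t) :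
    (a * u + b * v) ^ 2 / (a * s + b * t) ≤ a * (u ^ 2 / s) + b * (v ^ 2 / t) := by
  have hdiff : a * (u ^ 2 / s) + b * (v ^ 2 / t) - (a * u + b * v) ^ 2 / (a * s + b * t)
      = a * b * (u * t - v * s) ^ 2 / (s * t * (a * s + b * t)) := by
    field_simp
    ring
  have hnonneg : 0 ≤ a * b * (u * t - v * s) ^ 2 / (s * t * (a * s + b * t)) := by positivity
  linarith

/-- Below the threshold `v (η / (r |r - 1|)) ^ (1 / r)`, the numerator of the second derivative
of `t ↦ (t / v) ^ r - η log t` is nonnegative. -/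
theorem add_mul_rpow_div_nonneg {r η v t : ℝ} (hv : 0 < v)
    (h : (0 < r ∧ r < 1 ∧ 0 < η) ∨ (r < 0 ∧ η < 0)) (ht : 0 < t)
    (htb : t < v * (η / (r * |r - 1|)) ^ (1 / r)) :
    0 ≤ η + r * (r - 1) * (t / v) ^ r := by
  have htv : 0 < t / v := div_pos ht hv
  have hlt : t / v < (η / (r * |r - 1|)) ^ r⁻¹ := by
    rw [div_lt_iff₀' hv, ← one_div]
    exact htb
  have habs : |r - 1| = 1 - r := by
    rw [abs_of_neg] <;> rcases h with h | h <;> linarith [h.1, h.2]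
  rw [habs] at hlt
  rcases h with ⟨hr0, hr1, hη⟩ | ⟨hr, hη⟩
  · have hd : 0 < r * (1 - r) := mul_pos hr0 (by linarith)
    rw [Real.lt_rpow_inv_iff_of_pos htv.le (div_pos hη hd).le hr0, lt_div_iff₀ hd] at hlt
    linarith
  · have hd : r * (1 - r) < 0 := mul_neg_of_neg_of_pos hr (by linarith)
    rw [Real.lt_rpow_inv_iff_of_neg htv (div_pos_of_neg_of_neg hη hd) hr,
      div_lt_iff_of_neg hd] at hlt
    linarith

theorem convexOn_rpow_div_sub_mul_log {r η v : ℝ} (hv : 0 < v)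
    (h : (0 < r ∧ r < 1 ∧ 0 < η) ∨ (r < 0 ∧ η < 0)) :
    ConvexOn ℝ (Set.Ioo 0 (v * (η / (r * |r - 1|)) ^ (1 / r)))
      (fun t => (t / v) ^ r - η * Real.log t) := by
  have hrpow (p : ℝ) {t : ℝ} (ht : 0 < t) :
      HasDerivAt (fun t => (t / v) ^ p) (1 / v * p * (t / v) ^ (p - 1)) t :=
    ((hasDerivAt_id t).div_const v).rpow_const (Or.inl (div_pos ht hv).ne')
  have hderiv {t : ℝ} (ht : 0 < t) : HasDerivAt (fun t => (t / v) ^ r - η * Real.log t)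
      (1 / v * r * (t / v) ^ (r - 1) - η * t⁻¹) t :=
    (hrpow r ht).sub ((Real.hasDerivAt_log ht.ne').const_mul η)
  have hderiv2 {t : ℝ} (ht : 0 < t) :
      HasDerivAt (fun t => 1 / v * r * (t / v) ^ (r - 1) - η * t⁻¹)
        (1 / v * r * (1 / v * (r - 1) * (t / v) ^ (r - 1 - 1)) - η * -(t ^ 2)⁻¹) t :=
    ((hrpow (r - 1) ht).const_mul _).sub ((hasDerivAt_inv ht.ne').const_mul η)
  refine convexOn_of_hasDerivWithinAt2_nonneg (convex_Ioo _ _)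
    (fun t ht => (hderiv ht.1).continuousAt.continuousWithinAt)
    (fun t ht => (hderiv (interior_subset ht).1).hasDerivWithinAt)
    (fun t ht => (hderiv2 (interior_subset ht).1).hasDerivWithinAt) fun t ht => ?_
  obtain ⟨ht0, htb⟩ := interior_subset ht
  have htv : 0 < t / v := div_pos ht0 hv
  have hnum := add_mul_rpow_div_nonneg hv h ht0 htb
  have heq : 1 / v * r * (1 / v * (r - 1) * (t / v) ^ (r - 1 - 1)) - η * -(t ^ 2)⁻¹
      = (η + r * (r - 1) * (t / v) ^ r) / t ^ 2 := by
    rw [Real.rpow_sub_one htv.ne', Real.rpow_sub_one htv.ne']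
    field_simp
    ring
  rw [heq]
  positivity

theorem ggibbs_eq_sum (N M K : ℕ) (F : Matrix (Fin M) (Fin N) ℝ)
    (R : Matrix (Fin K) (Fin N) ℝ) (y : Fin M → ℝ) (r η rt ηt vtht : ℝ) (vth : Fin K → ℝ)
    (p : (Fin N → ℝ) × (Fin K → ℝ) × ℝ) :
    ggibbs N M K F R y r η rt ηt vtht vth p =
      1 / 2 * ∑ j, (F.mulVec p.1 j - y j) ^ 2 / p.2.2
        + 1 / 2 * ∑ i, R.mulVec p.1 i ^ 2 / p.2.1 i
        + ((p.2.2 / vtht) ^ rt - ηt * Real.log p.2.2)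
        + ∑ i, ((p.2.1 i / vth i) ^ r - η * Real.log (p.2.1 i)) := by
  rw [ggibbs, Finset.sum_sub_distrib, ← Finset.mul_sum, ← Finset.sum_div]
  ring

/-- If `(0 < r < 1 ∧ η > 0)` or `r < 0`, and `(0 < r̃ < 1 ∧ η̃ > 0)` or `r̃ < 0`, the
generalized Gibbs energy functional is convex on the region where
`θᵢ < ϑᵢ (η/(r|r−1|))^{1/r}` for all `i` and `ν < ϑ̃ (η̃/(r̃|r̃−1|))^{1/r̃}`. -/
theorem statement7 (N M K : ℕ) (hN : 0 < N) (hM : 0 < M) (hK : 0 < K)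
    (F : Matrix (Fin M) (Fin N) ℝ) (R : Matrix (Fin K) (Fin N) ℝ) (y : Fin M → ℝ)
    (r β η : ℝ) (hr0 : r ≠ 0) (hβ : 0 < β) (hη_def : η = r * β - 3 / 2)
    (vth : Fin K → ℝ) (hvth : ∀ i, 0 < vth i)
    (rt βt ηt vtht : ℝ) (hrt0 : rt ≠ 0) (hβt : 0 < βt)
    (hηt_def : ηt = rt * βt - (M + 2 : ℝ) / 2) (hvtht : 0 < vtht)
    (hcase_r : (0 < r ∧ r < 1 ∧ 0 < η) ∨ r < 0)
    (hcase_rt : (0 < rt ∧ rt < 1 ∧ 0 < ηt) ∨ rt < 0) :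
    ConvexOn ℝ
      {p : (Fin N → ℝ) × (Fin K → ℝ) × ℝ |
        (∀ i, 0 < p.2.1 i ∧ p.2.1 i < vth i * (η / (r * |r - 1|)) ^ (1 / r)) ∧
        0 < p.2.2 ∧ p.2.2 < vtht * (ηt / (rt * |rt - 1|)) ^ (1 / rt)}
      (ggibbs N M K F R y r η rt ηt vtht vth) := by
  have hη : (0 < r ∧ r < 1 ∧ 0 < η) ∨ (r < 0 ∧ η < 0) :=
    hcase_r.imp_right fun hr => ⟨hr, by nlinarith⟩
  have hηt : (0 < rt ∧ rt < 1 ∧ 0 < ηt) ∨ (rt < 0 ∧ ηt < 0) := by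
    refine hcase_rt.imp_right fun hr => ⟨hr, ?_⟩
    have hM0 : (0 : ℝ) ≤ M := M.cast_nonneg
    nlinarith
  have hθ (i : Fin K) := convexOn_rpow_div_sub_mul_log (hvth i) hη
  have hν := convexOn_rpow_div_sub_mul_log hvtht hηt
  refine ⟨fun p hp q hq a b ha hb hab =>
    ⟨fun i => (hθ i).1 (hp.1 i) (hq.1 i) ha hb hab, hν.1 hp.2 hq.2 ha hb hab⟩, ?_⟩
  intro p hp q hq a b ha hb hab
  have hFsq (j : Fin M) : (F.mulVec (a • p + b • q).1 j - y j) ^ 2 / (a • p + b • q).2.2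
      ≤ a * ((F.mulVec p.1 j - y j) ^ 2 / p.2.2)
        + b * ((F.mulVec q.1 j - y j) ^ 2 / q.2.2) := by
    have haff : F.mulVec (a • p + b • q).1 j - y j
        = a * (F.mulVec p.1 j - y j) + b * (F.mulVec q.1 j - y j) := by
      simp only [Prod.fst_add, Prod.smul_fst, Matrix.mulVec_add, Matrix.mulVec_smul,
        Pi.add_apply, Pi.smul_apply, smul_eq_mul]
      linear_combination y j * hab
    rw [haff]
    exact sq_div_convexCombination_le _ _ ha hb hp.2.1 hq.2.1
      (hν.1 hp.2 hq.2 ha hb hab).1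
  have hRsq (i : Fin K) : R.mulVec (a • p + b • q).1 i ^ 2 / (a • p + b • q).2.1 i
      ≤ a * (R.mulVec p.1 i ^ 2 / p.2.1 i) + b * (R.mulVec q.1 i ^ 2 / q.2.1 i) := by
    have hlin : R.mulVec (a • p + b • q).1 i = a * R.mulVec p.1 i + b * R.mulVec q.1 i := by
      simp only [Prod.fst_add, Prod.smul_fst, Matrix.mulVec_add, Matrix.mulVec_smul,
        Pi.add_apply, Pi.smul_apply, smul_eq_mul]
    rw [hlin]
    exact sq_div_convexCombination_le _ _ ha hb (hp.1 i).1 (hq.1 i).1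
      ((hθ i).1 (hp.1 i) (hq.1 i) ha hb hab).1
  have hFsum := Finset.sum_le_sum fun j (_ : j ∈ Finset.univ) => hFsq j
  have hRsum := Finset.sum_le_sum fun i (_ : i ∈ Finset.univ) => hRsq i
  have hθsum := Finset.sum_le_sum fun i (_ : i ∈ Finset.univ) =>
    (hθ i).2 (hp.1 i) (hq.1 i) ha hb hab
  have hνle := hν.2 hp.2 hq.2 ha hb hab
  simp only [Finset.sum_add_distrib, ← Finset.mul_sum, smul_eq_mul] at hFsum hRsum hθsum hνle
  simp only [ggibbs_eq_sum, smul_eq_mul]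
  simp only [Prod.fst_add, Prod.snd_add, Prod.smul_fst, Prod.smul_snd, Pi.add_apply,
    Pi.smul_apply, smul_eq_mul] at hFsum hRsum ⊢
  linarith
end

section
/- Fix ν > 0 and assume the common kernel condition ker(F) ∩ ker(R) = {0}. If r ≥ 1 and η = rβ − 3/2 > 0, then the function (x, θ) ↦ (1/(2ν))‖Fx − y‖₂² + (1/2)∑_{i=1}^K ([Rx]_i)²/θ_i + ∑_{i=1}^K (θ_i/ϑ_i)^r − η ∑_{i=1}^K log θ_i is strictly convex on ℝ^N × ℝ_{++}^K. -/
open Real Filter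

/-- The defect of convexity of the perspective function `(u, s) ↦ u² / s`. -/
lemma sq_div_convexity_defect {a b s t : ℝ} (u v : ℝ) (ha : 0 < a) (hb : 0 < b)
    (hs : 0 < s) (ht : 0 < t) :
    a * (u ^ 2 / s) + b * (v ^ 2 / t) - (a * u + b * v) ^ 2 / (a * s + b * t)
      = a * b * (u * t - v * s) ^ 2 / (s * t * (a * s + b * t)) := by
  have h : a * s + b * t ≠ 0 := by positivity
  field_simp
  ring

lemma sq_div_combo_le {a b s t : ℝ} (u v : ℝ) (ha : 0 < a) (hb : 0 < b)
    (hs : 0 < s) (ht : 0 < t) :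
    (a * u + b * v) ^ 2 / (a * s + b * t) ≤ a * (u ^ 2 / s) + b * (v ^ 2 / t) := by
  have h := sq_div_convexity_defect u v ha hb hs ht
  have h' : 0 ≤ a * b * (u * t - v * s) ^ 2 / (s * t * (a * s + b * t)) := by positivity
  linarith

lemma sq_div_combo_lt {a b s t u v : ℝ} (ha : 0 < a) (hb : 0 < b)
    (hs : 0 < s) (ht : 0 < t) (huv : u * t ≠ v * s) :
    (a * u + b * v) ^ 2 / (a * s + b * t) < a * (u ^ 2 / s) + b * (v ^ 2 / t) := by
  have h := sq_div_convexity_defect u v ha hb hs ht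
  have hne : u * t - v * s ≠ 0 := sub_ne_zero.2 huv
  have h' : 0 < a * b * (u * t - v * s) ^ 2 / (s * t * (a * s + b * t)) := by positivity
  linarith

/-- The defect of convexity of the shifted square `u ↦ (u - c)²`. -/
lemma sq_sub_convexity_defect {a b : ℝ} (u v c : ℝ) (hab : a + b = 1) :
    a * (u - c) ^ 2 + b * (v - c) ^ 2 - (a * u + b * v - c) ^ 2 = a * b * (u - v) ^ 2 := by
  obtain rfl : b = 1 - a := by linarith
  ring

lemma sum_combo_le {ι : Type*} [Fintype ι] {a b : ℝ} {f g h : ι → ℝ}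
    (hle : ∀ i, f i ≤ a * g i + b * h i) :
    ∑ i, f i ≤ a * ∑ i, g i + b * ∑ i, h i := by
  rw [Finset.mul_sum, Finset.mul_sum, ← Finset.sum_add_distrib]
  exact Finset.sum_le_sum fun i _ => hle i

lemma sum_combo_lt {ι : Type*} [Fintype ι] {a b : ℝ} {f g h : ι → ℝ}
    (hle : ∀ i, f i ≤ a * g i + b * h i) (hlt : ∃ i, f i < a * g i + b * h i) :
    ∑ i, f i < a * ∑ i, g i + b * ∑ i, h i := by
  rw [Finset.mul_sum, Finset.mul_sum, ← Finset.sum_add_distrib]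
  obtain ⟨i, hi⟩ := hlt
  exact Finset.sum_lt_sum (fun i _ => hle i) ⟨i, Finset.mem_univ i, hi⟩

/-- Fix `ν > 0` and assume `ker F ∩ ker R = {0}`. If `r ≥ 1` and `η = rβ − 3/2 > 0`,
then `(x, θ) ↦ (1/(2ν))‖Fx − y‖₂² + (1/2)∑ᵢ ([Rx]ᵢ)²/θᵢ + ∑ᵢ (θᵢ/ϑᵢ)^r − η ∑ᵢ log θᵢ`
is strictly convex on `ℝ^N × ℝ_{++}^K`. -/
theorem statement8 (N M K : ℕ) (hN : 0 < N) (hM : 0 < M) (hK : 0 < K)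
    (F : Matrix (Fin M) (Fin N) ℝ) (R : Matrix (Fin K) (Fin N) ℝ) (y : Fin M → ℝ)
    (hker : LinearMap.ker F.mulVecLin ⊓ LinearMap.ker R.mulVecLin = ⊥)
    (ν : ℝ) (hν : 0 < ν)
    (r β η : ℝ) (hr0 : r ≠ 0) (hβ : 0 < β) (hη_def : η = r * β - 3 / 2)
    (vth : Fin K → ℝ) (hvth : ∀ i, 0 < vth i)
    (hr : 1 ≤ r) (hη : 0 < η) :
    StrictConvexOn ℝ {p : (Fin N → ℝ) × (Fin K → ℝ) | ∀ i, 0 < p.2 i}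
      (fun p : (Fin N → ℝ) × (Fin K → ℝ) =>
        (1 / (2 * ν)) * ∑ j, (F.mulVec p.1 j - y j) ^ 2
          + (1 / 2) * ∑ i, (R.mulVec p.1 i) ^ 2 / p.2 i
          + ∑ i, (p.2 i / vth i) ^ r
          - η * ∑ i, Real.log (p.2 i)) := by
  refine ⟨?_, ?_⟩
  · intro p hp q hq a b ha hb hab i
    exact (convex_Ioi (0 : ℝ)) (hp i) (hq i) ha hb hab
  rintro ⟨x, s⟩ hs ⟨z, t⟩ ht hne a b ha hb hab
  simp only [Set.mem_ofPred_eq] at hs ht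
  have hlin : ∀ {m : ℕ} (A : Matrix (Fin m) (Fin N) ℝ) (j : Fin m),
      A.mulVec (a • x + b • z) j = a * A.mulVec x j + b * A.mulVec z j := by
    intro m A j
    simp [Matrix.mulVec_add, Matrix.mulVec_smul]
  simp only [Prod.smul_mk, Prod.mk_add_mk, hlin, Pi.add_apply, Pi.smul_apply, smul_eq_mul]
  have hfit_le (j : Fin M) : (a * F.mulVec x j + b * F.mulVec z j - y j) ^ 2
      ≤ a * (F.mulVec x j - y j) ^ 2 + b * (F.mulVec z j - y j) ^ 2 := by
    have h := sq_sub_convexity_defect (F.mulVec x j) (F.mulVec z j) (y j) hab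
    have h' : 0 ≤ a * b * (F.mulVec x j - F.mulVec z j) ^ 2 := by positivity
    linarith
  have hreg_le (i : Fin K) := sq_div_combo_le (R.mulVec x i) (R.mulVec z i) ha hb (hs i) (ht i)
  have hpow_le (i : Fin K) : ((a * s i + b * t i) / vth i) ^ r
      ≤ a * (s i / vth i) ^ r + b * (t i / vth i) ^ r := by
    have h := (convexOn_rpow hr).2 (Set.mem_Ici.2 (div_pos (hs i) (hvth i)).le)
      (Set.mem_Ici.2 (div_pos (ht i) (hvth i)).le) ha.le hb.le hab
    simpa only [smul_eq_mul, add_div, mul_div_assoc] using h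
  have hlog_le (i : Fin K) : -Real.log (a * s i + b * t i)
      ≤ a * -Real.log (s i) + b * -Real.log (t i) := by
    have h := strictConcaveOn_log_Ioi.concaveOn.2 (hs i) (ht i) ha.le hb.le hab
    simp only [smul_eq_mul] at h
    linarith
  have hfit := sum_combo_le hfit_le
  have hreg := sum_combo_le hreg_le
  have hpow := sum_combo_le hpow_le
  have hlog := sum_combo_le hlog_le
  simp only [Finset.sum_neg_distrib] at hlog
  by_cases hst : s = t
  · subst hst
    have hxz : x - z ≠ 0 := by
      rw [sub_ne_zero]
      rintro rfl
      exact hne rfl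
    have hsep : F.mulVec x ≠ F.mulVec z ∨ R.mulVec x ≠ R.mulVec z := by
      by_contra! h
      apply hxz
      rw [← Submodule.mem_bot ℝ, ← hker]
      simp [Matrix.mulVec_sub, h.1, h.2]
    rcases hsep with hF | hR
    · obtain ⟨j, hj⟩ := Function.ne_iff.1 hF
      have hfit_lt := sum_combo_lt hfit_le ⟨j, by
        have h := sq_sub_convexity_defect (F.mulVec x j) (F.mulVec z j) (y j) hab
        have hj' := sub_ne_zero.2 hj
        have h' : 0 < a * b * (F.mulVec x j - F.mulVec z j) ^ 2 := by positivity
        linarith⟩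
      linear_combination (1 / (2 * ν)) * hfit_lt + (1 / 2) * hreg + hpow + η * hlog
    · obtain ⟨i, hi⟩ := Function.ne_iff.1 hR
      have hreg_lt := sum_combo_lt hreg_le
        ⟨i, sq_div_combo_lt ha hb (hs i) (ht i) fun h => hi (mul_right_cancel₀ (hs i).ne' h)⟩
      linear_combination (1 / (2 * ν)) * hfit + (1 / 2) * hreg_lt + hpow + η * hlog
  · obtain ⟨i, hi⟩ := Function.ne_iff.1 hst
    have hlog_lt := sum_combo_lt hlog_le ⟨i, by
      have h := strictConcaveOn_log_Ioi.2 (hs i) (ht i) hi ha hb hab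
      simp only [smul_eq_mul] at h
      linarith⟩
    simp only [Finset.sum_neg_distrib] at hlog_lt
    linear_combination (1 / (2 * ν)) * hfit + (1 / 2) * hreg + hpow + η * hlog_lt
end

section
/- Fix ν > 0. If either (0 < r < 1 and η > 0) or (r < 0), where η = rβ − 3/2, then the function (x, θ) ↦ (1/(2ν))‖Fx − y‖₂² + (1/2)∑_{i=1}^K ([Rx]_i)²/θ_i + ∑_{i=1}^K (θ_i/ϑ_i)^r − η ∑_{i=1}^K log θ_i is convex on the convex open region of all (x, θ) ∈ ℝ^N × ℝ_{++}^K satisfying θ_i < ϑ_i (η/(r·|r − 1|))^{1/r} for every i = 1, …, K. -/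
open Real Filter

/-- The perspective of the square, `(u, t) ↦ u ^ 2 / t`, is convex on the half-space `t > 0`. -/
theorem convexOn_sq_div : ConvexOn ℝ {q : ℝ × ℝ | 0 < q.2} (fun q : ℝ × ℝ => q.1 ^ 2 / q.2) := by
  refine ⟨(convex_Ioi (0 : ℝ)).linear_preimage (LinearMap.snd ℝ ℝ ℝ), ?_⟩
  rintro ⟨u, s⟩ hs ⟨v, t⟩ ht a b ha hb hab
  simp only [Set.mem_ofPred_eq] at hs ht
  have hpos : 0 < a * s + b * t := by
    rcases ha.eq_or_lt with rfl | ha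
    · simp_all
    · positivity
  simp only [Prod.smul_mk, Prod.mk_add_mk, smul_eq_mul]
  rw [div_le_iff₀ hpos]
  have key : (a * (u ^ 2 / s) + b * (v ^ 2 / t)) * (a * s + b * t) - (a * u + b * v) ^ 2
      = a * b * ((t * u - s * v) ^ 2 / (s * t)) := by
    field_simp
    ring
  have : 0 ≤ a * b * ((t * u - s * v) ^ 2 / (s * t)) := by positivity
  linarith

/-- A finite sum of convex functions is convex. -/
theorem convexOn_finset_sum {E ι : Type*} [AddCommGroup E] [Module ℝ E] {S : Set E}
    (hS : Convex ℝ S) (s : Finset ι) {f : ι → E → ℝ} (hf : ∀ i ∈ s, ConvexOn ℝ S (f i)) :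
    ConvexOn ℝ S (fun x => ∑ i ∈ s, f i x) := by
  refine ⟨hS, fun x hx y hy a b ha hb hab => ?_⟩
  simp only [Finset.smul_sum, ← Finset.sum_add_distrib]
  exact Finset.sum_le_sum fun i hi => (hf i hi).2 hx hy ha hb hab

/-- The function `t ↦ (t / v) ^ r - η * log t` is convex on any interval `(0, b)` on which
`r * (1 - r) * (t / v) ^ r ≤ η`. -/
theorem convexOn_div_rpow_sub_log {v r η b : ℝ} (hv : 0 < v)
    (h : ∀ t ∈ Set.Ioo 0 b, r * (1 - r) * (t / v) ^ r ≤ η) :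
    ConvexOn ℝ (Set.Ioo 0 b) (fun t => (t / v) ^ r - η * log t) := by
  have hd1 : ∀ t ∈ Set.Ioo 0 b,
      HasDerivAt (fun t => (t / v) ^ r - η * log t) (r / v * (t / v) ^ (r - 1) - η * t⁻¹) t := by
    intro t ht
    have htv : t / v ≠ 0 := (div_pos ht.1 hv).ne'
    refine ((((hasDerivAt_id' t).div_const v).rpow_const (p := r) (Or.inl htv)).sub
      ((hasDerivAt_log ht.1.ne').const_mul η)).congr_deriv ?_
    ring
  have hd2 : ∀ t ∈ Set.Ioo 0 b,
      HasDerivAt (fun t => r / v * (t / v) ^ (r - 1) - η * t⁻¹)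
        ((η - r * (1 - r) * (t / v) ^ r) / t ^ 2) t := by
    intro t ht
    have ht0 : t ≠ 0 := ht.1.ne'
    have htv : 0 < t / v := div_pos ht.1 hv
    refine (((((hasDerivAt_id' t).div_const v).rpow_const (p := r - 1)
      (Or.inl htv.ne')).const_mul (r / v)).sub
      ((hasDerivAt_inv ht0).const_mul η)).congr_deriv ?_
    rw [show r - 1 - 1 = r - 2 by ring, rpow_sub htv, rpow_two]
    field_simp
    ring
  refine convexOn_of_hasDerivWithinAt2_nonneg (convex_Ioo 0 b)
    (f' := fun t => r / v * (t / v) ^ (r - 1) - η * t⁻¹)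
    (f'' := fun t => (η - r * (1 - r) * (t / v) ^ r) / t ^ 2)
    (fun t ht => (hd1 t ht).continuousAt.continuousWithinAt) ?_ ?_ ?_
  all_goals rw [interior_Ioo]; intro t ht
  · exact (hd1 t ht).hasDerivWithinAt
  · exact (hd2 t ht).hasDerivWithinAt
  · exact div_nonneg (sub_nonneg.2 (h t ht)) (sq_nonneg t)

/-- Below the threshold `v * (η / (r * |r - 1|)) ^ (1 / r)` the bound
`r * (1 - r) * (t / v) ^ r ≤ η` holds, when `r < 1` is nonzero and has the sign of `η`. -/
theorem mul_div_rpow_le_of_lt_threshold {v r η t : ℝ} (hv : 0 < v) (ht : 0 < t)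
    (hcase : (0 < r ∧ r < 1 ∧ 0 < η) ∨ (r < 0 ∧ η < 0))
    (hlt : t < v * (η / (r * |r - 1|)) ^ (1 / r)) :
    r * (1 - r) * (t / v) ^ r ≤ η := by
  have hr1 : r < 1 := by rcases hcase with h | h <;> linarith
  rw [abs_of_neg (sub_neg.2 hr1), neg_sub] at hlt
  have htv : 0 < t / v := div_pos ht hv
  have hlt' : t / v < (η / (r * (1 - r))) ^ (1 / r) := by rwa [div_lt_iff₀' hv]
  rcases hcase with ⟨hr, -, hη⟩ | ⟨hr, hη⟩
  · have hc : 0 < r * (1 - r) := mul_pos hr (sub_pos.2 hr1)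
    have hle := rpow_le_rpow htv.le hlt'.le hr.le
    rw [← rpow_mul (div_pos hη hc).le, one_div_mul_cancel hr.ne', rpow_one,
      le_div_iff₀' hc] at hle
    exact hle
  · have hc : r * (1 - r) < 0 := mul_neg_of_neg_of_pos hr (sub_pos.2 hr1)
    have hle := rpow_le_rpow_of_nonpos htv hlt'.le hr.le
    rw [← rpow_mul (div_pos_of_neg_of_neg hη hc).le, one_div_mul_cancel hr.ne, rpow_one,
      div_le_iff_of_neg' hc] at hle
    exact hle

/-- Fix `ν > 0`. If `(0 < r < 1 ∧ η > 0)` or `r < 0`, then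
`(x, θ) ↦ (1/(2ν))‖Fx − y‖₂² + (1/2)∑ᵢ ([Rx]ᵢ)²/θᵢ + ∑ᵢ (θᵢ/ϑᵢ)^r − η ∑ᵢ log θᵢ`
is convex on the region where `0 < θᵢ < ϑᵢ (η/(r|r−1|))^{1/r}` for all `i`. -/
theorem statement9 (N M K : ℕ) (hN : 0 < N) (hM : 0 < M) (hK : 0 < K)
    (F : Matrix (Fin M) (Fin N) ℝ) (R : Matrix (Fin K) (Fin N) ℝ) (y : Fin M → ℝ)
    (ν : ℝ) (hν : 0 < ν)
    (r β η : ℝ) (hr0 : r ≠ 0) (hβ : 0 < β) (hη_def : η = r * β - 3 / 2)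
    (vth : Fin K → ℝ) (hvth : ∀ i, 0 < vth i)
    (hcase : (0 < r ∧ r < 1 ∧ 0 < η) ∨ r < 0) :
    ConvexOn ℝ
      {p : (Fin N → ℝ) × (Fin K → ℝ) |
        ∀ i, 0 < p.2 i ∧ p.2 i < vth i * (η / (r * |r - 1|)) ^ (1 / r)}
      (fun p : (Fin N → ℝ) × (Fin K → ℝ) =>
        (1 / (2 * ν)) * ∑ j, (F.mulVec p.1 j - y j) ^ 2
          + (1 / 2) * ∑ i, (R.mulVec p.1 i) ^ 2 / p.2 i
          + ∑ i, (p.2 i / vth i) ^ r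
          - η * ∑ i, Real.log (p.2 i)) := by
  have hη : (0 < r ∧ r < 1 ∧ 0 < η) ∨ (r < 0 ∧ η < 0) :=
    hcase.imp_right fun hr => ⟨hr, by nlinarith [mul_neg_of_neg_of_pos hr hβ]⟩
  set S : Set ((Fin N → ℝ) × (Fin K → ℝ)) :=
    {p | ∀ i, 0 < p.2 i ∧ p.2 i < vth i * (η / (r * |r - 1|)) ^ (1 / r)} with hS_def
  let coord (i : Fin K) : (Fin N → ℝ) × (Fin K → ℝ) →ₗ[ℝ] ℝ :=
    LinearMap.proj i ∘ₗ LinearMap.snd ℝ _ _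
  let regOp (i : Fin K) : (Fin N → ℝ) × (Fin K → ℝ) →ₗ[ℝ] ℝ :=
    LinearMap.proj i ∘ₗ R.mulVecLin ∘ₗ LinearMap.fst ℝ _ _
  let fwdOp (j : Fin M) : (Fin N → ℝ) × (Fin K → ℝ) →ₗ[ℝ] ℝ :=
    LinearMap.proj j ∘ₗ F.mulVecLin ∘ₗ LinearMap.fst ℝ _ _
  have hS : Convex ℝ S := by
    have hS_eq : S = ⋂ i, coord i ⁻¹' Set.Ioo 0 (vth i * (η / (r * |r - 1|)) ^ (1 / r)) := by
      ext p
      simp [hS_def, coord]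
    rw [hS_eq]
    exact convex_iInter fun i => (convex_Ioo _ _).linear_preimage (coord i)
  have hfid : ConvexOn ℝ S (fun p => ∑ j, (F.mulVec p.1 j - y j) ^ 2) := by
    refine convexOn_finset_sum hS _ fun j _ => ?_
    have h := ((even_two.convexOn_pow (𝕜 := ℝ)).translate_left (-y j)).comp_linearMap (fwdOp j)
    refine (h.subset (fun _ _ => Set.mem_univ _) hS).congr fun p _ => ?_
    simp [fwdOp, sub_eq_add_neg]
  have hreg : ConvexOn ℝ S (fun p => ∑ i, (R.mulVec p.1 i) ^ 2 / p.2 i) := by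
    refine convexOn_finset_sum hS _ fun i _ => ?_
    exact (convexOn_sq_div.comp_linearMap ((regOp i).prod (coord i))).subset
      (fun p hp => (hp i).1) hS
  have hprior : ConvexOn ℝ S (fun p => ∑ i, ((p.2 i / vth i) ^ r - η * log (p.2 i))) := by
    refine convexOn_finset_sum hS _ fun i _ => ?_
    exact ((convexOn_div_rpow_sub_log (hvth i) fun t ht =>
      mul_div_rpow_le_of_lt_threshold (hvth i) ht.1 hη ht.2).comp_linearMap (coord i)).subset
      (fun p hp => hp i) hS
  refine (((hfid.smul (c := 1 / (2 * ν)) (by positivity)).add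
    (hreg.smul (c := 1 / 2) (by positivity))).add hprior).congr fun p _ => ?_
  simp only [Pi.add_apply, smul_eq_mul, Finset.sum_sub_distrib, ← Finset.mul_sum]
  ring
end
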